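/- arXiv:2310.05463 — 4 statements merged into one kernel-verified Lean document; each statement's English description precedes it below -/
import Mathlib

section
/- Let 1/2 < γ ≤ 1, x > 0 and K > 0. Suppose F: [0,∞) → ℝ is nondecreasing and globally Hölder of order γ, i.e. there is C with |F(u) − F(v)| ≤ C|u−v|^γ for all u,v ≥ 0, and suppose lim_{t→0} |F(x+t) − F(x)|/|t|^γ = K. Then with H_x(δ) := ∫_0^1 ( F(x+uδ) − F(x) ) du one has lim_{δ→0} H_x(δ)/( sgn(δ)·|δ|^γ ) = K/(γ+1). -/
open MeasureTheory

/-- The increment of a function that is monotone on `[0, ∞)` has the sign of the step. -/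
lemma MonotoneOn.sub_div_sign_mul {F : ℝ → ℝ} (hF : MonotoneOn F (Set.Ici 0)) {x δ u a : ℝ}
    (hδ0 : δ ≠ 0) (hδ : |δ| < x) (hu0 : 0 ≤ u) (hu1 : u ≤ 1) :
    (F (x + u * δ) - F x) / (Real.sign δ * a) = |F (x + u * δ) - F x| / a := by
  obtain ⟨h₁, h₂⟩ := abs_lt.mp hδ
  have hx : 0 ≤ x := (abs_nonneg δ).trans hδ.le
  have hp : 0 ≤ x + u * δ := by nlinarith
  rcases hδ0.lt_or_gt with h | h
  · have hle : F (x + u * δ) ≤ F x := hF hp hx (by nlinarith)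
    rw [Real.sign_of_neg h, abs_of_nonpos (by linarith), neg_one_mul, div_neg, neg_div]
  · have hle : F x ≤ F (x + u * δ) := hF hx hp (by nlinarith)
    rw [Real.sign_of_pos h, abs_of_nonneg (by linarith), one_mul]

/-- If `F` is nondecreasing and globally Hölder of order `γ ∈ (1/2, 1]` on `[0,∞)` and
`|F(x+t)−F(x)|/|t|^γ → K` as `t → 0`, then
`H_x(δ)/(sgn(δ)·|δ|^γ) → K/(γ+1)` as `δ → 0`, where
`H_x(δ) = ∫_0^1 (F(x+uδ) − F(x)) du`. -/
theorem holder_class_H_limit (γ x K : ℝ) (hγ1 : 1 / 2 < γ) (hγ2 : γ ≤ 1)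
    (hx : 0 < x) (hK : 0 < K)
    (F : ℝ → ℝ) (hmono : MonotoneOn F (Set.Ici 0))
    (C : ℝ)
    (hHolder : ∀ u v : ℝ, 0 ≤ u → 0 ≤ v → |F u - F v| ≤ C * |u - v| ^ γ)
    (hlim : Filter.Tendsto (fun t : ℝ => |F (x + t) - F x| / |t| ^ γ)
      (nhdsWithin 0 {0}ᶜ) (nhds K)) :
    Filter.Tendsto
      (fun δ : ℝ => (∫ u in (0 : ℝ)..1, (F (x + u * δ) - F x)) / (Real.sign δ * |δ| ^ γ))
      (nhdsWithin 0 {0}ᶜ) (nhds (K / (γ + 1))) := by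
  have hpos : ∀ δ u : ℝ, |δ| < x → 0 ≤ u → u ≤ 1 → 0 ≤ x + u * δ := by
    intro δ u hδ hu0 hu1
    nlinarith [abs_lt.mp hδ]
  have hsmall : ∀ᶠ δ : ℝ in nhdsWithin 0 {0}ᶜ, δ ≠ 0 ∧ |δ| < x := by
    refine eventually_mem_nhdsWithin.and (nhdsWithin_le_nhds ?_)
    exact (continuous_abs.tendsto' (0 : ℝ) 0 abs_zero).eventually_lt_const hx
  have hlimit : ∫ u in (0 : ℝ)..1, K * u ^ γ = K / (γ + 1) := by
    rw [intervalIntegral.integral_const_mul, integral_rpow (Or.inl (by linarith)),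
      Real.one_rpow, Real.zero_rpow (by linarith), sub_zero, mul_one_div]
  simp_rw [← intervalIntegral.integral_div]
  rw [← hlimit]
  refine intervalIntegral.tendsto_integral_filter_of_dominated_convergence (fun _ => |C|)
    ?_ ?_ intervalIntegrable_const ?_
  · filter_upwards [hsmall] with δ hδ
    have hmeas : Measurable (fun y : ℝ => F (max 0 y)) := Monotone.measurable fun a b hab =>
      hmono (le_max_left 0 a) (le_max_left 0 b) (max_le_max le_rfl hab)
    have hcomp : Measurable
        (fun u : ℝ => (F (max 0 (x + u * δ)) - F x) / (Real.sign δ * |δ| ^ γ)) :=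
      ((hmeas.comp (by fun_prop : Measurable fun u : ℝ => x + u * δ)).sub_const _).div_const _
    refine hcomp.aestronglyMeasurable.congr ?_
    filter_upwards [ae_restrict_mem measurableSet_uIoc] with u hu
    rw [Set.uIoc_of_le zero_le_one] at hu
    rw [max_eq_right (hpos δ u hδ.2 hu.1.le hu.2)]
  · filter_upwards [hsmall] with δ hδ
    refine Filter.Eventually.of_forall fun u hu => ?_
    rw [Set.uIoc_of_le zero_le_one] at hu
    have hδpos : 0 < |δ| ^ γ := Real.rpow_pos_of_pos (abs_pos.mpr hδ.1) γ
    rw [hmono.sub_div_sign_mul hδ.1 hδ.2 hu.1.le hu.2, Real.norm_of_nonneg (by positivity),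
      div_le_iff₀ hδpos]
    have hle : |u * δ| ≤ |δ| := by
      rw [abs_mul, abs_of_pos hu.1]
      exact mul_le_of_le_one_left (abs_nonneg δ) hu.2
    calc |F (x + u * δ) - F x|
        ≤ C * |x + u * δ - x| ^ γ := hHolder _ _ (hpos δ u hδ.2 hu.1.le hu.2) hx.le
      _ ≤ |C| * |u * δ| ^ γ := by
          rw [add_sub_cancel_left]
          gcongr
          exact le_abs_self C
      _ ≤ |C| * |δ| ^ γ := by gcongr
  · refine Filter.Eventually.of_forall fun u hu => ?_
    rw [Set.uIoc_of_le zero_le_one] at hu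
    have hscale : Filter.Tendsto (fun δ : ℝ => u * δ) (nhdsWithin 0 {0}ᶜ)
        (nhdsWithin 0 {0}ᶜ) := by
      refine tendsto_nhdsWithin_of_tendsto_nhds_of_eventually_within _ ?_ ?_
      · exact ((continuous_const_mul u).tendsto' 0 0 (mul_zero u)).mono_left nhdsWithin_le_nhds
      · filter_upwards [hsmall] with δ hδ using mul_ne_zero hu.1.ne' hδ.1
    refine ((hlim.comp hscale).mul_const (u ^ γ)).congr' ?_
    filter_upwards [hsmall] with δ hδ
    have huγ : u ^ γ ≠ 0 := (Real.rpow_pos_of_pos hu.1 γ).ne'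
    rw [hmono.sub_div_sign_mul hδ.1 hδ.2 hu.1.le hu.2, Function.comp_apply, abs_mul,
      abs_of_pos hu.1, Real.mul_rpow hu.1.le (abs_nonneg δ)]
    field_simp
end

section
/- For all 0 < ε < 1 and all s, t ∈ [0,1), with y(ε,s,t) := ∫_ε^1 [ (y−εs)·(y−εt)·(1−y) ]^{−1/2} dy, one has y(ε,s,t) ≤ ( log(1/ε) + log( e²/(1 − max(s,t)) ) ) · (1 − max(s,t))^{−1/2} + 1. -/
open MeasureTheory

/-- An antiderivative of `1 / ((y - a) √(1 - y))` on `(a, 1)`. -/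
lemma hasDerivAt_log_sqrt_sub (a y : ℝ) (hay : a < y) (hy : y < 1) :
    HasDerivAt (fun x => (Real.sqrt (1 - a))⁻¹ *
        (Real.log (Real.sqrt (1 - a) - Real.sqrt (1 - x)) -
          Real.log (Real.sqrt (1 - a) + Real.sqrt (1 - x))))
      ((y - a) * Real.sqrt (1 - y))⁻¹ y := by
  have hu : 0 < Real.sqrt (1 - y) := Real.sqrt_pos.2 (by linarith)
  have hbu : Real.sqrt (1 - y) < Real.sqrt (1 - a) :=
    Real.sqrt_lt_sqrt (by linarith) (by linarith)
  have hu2 : Real.sqrt (1 - y) ^ 2 = 1 - y := Real.sq_sqrt (by linarith)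
  have hb2 : Real.sqrt (1 - a) ^ 2 = 1 - a := Real.sq_sqrt (by linarith)
  have hsqrt : HasDerivAt (fun x : ℝ => Real.sqrt (1 - x))
      (-1 / (2 * Real.sqrt (1 - y))) y :=
    ((hasDerivAt_id y).const_sub 1).sqrt (by simp only [id]; linarith)
  set b := Real.sqrt (1 - a)
  have h := (((hsqrt.const_sub b).log (by linarith)).sub
    ((hsqrt.const_add b).log (by linarith))).const_mul b⁻¹
  refine h.congr_deriv ?_
  set u := Real.sqrt (1 - y)
  have hya : y - a = (b - u) * (b + u) := by linear_combination hu2 - hb2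
  rw [hya]
  have h1 : b - u ≠ 0 := by linarith
  have h2 : b + u ≠ 0 := by linarith
  have h3 : b ≠ 0 := by linarith
  have h4 : u ≠ 0 := hu.ne'
  field_simp
  ring

lemma continuousOn_log_sqrt_sub (a c : ℝ) (hac : a < c) (hc : c < 1) :
    ContinuousOn (fun x => (Real.sqrt (1 - a))⁻¹ *
        (Real.log (Real.sqrt (1 - a) - Real.sqrt (1 - x)) -
          Real.log (Real.sqrt (1 - a) + Real.sqrt (1 - x)))) (Set.Icc c 1) := by
  have hb : 0 < Real.sqrt (1 - a) := Real.sqrt_pos.2 (by linarith)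
  refine continuousOn_const.mul (ContinuousOn.sub (ContinuousOn.log (by fun_prop) ?_)
    (ContinuousOn.log (by fun_prop) ?_))
  · intro x hx
    have : Real.sqrt (1 - x) < Real.sqrt (1 - a) :=
      Real.sqrt_lt_sqrt (by linarith [hx.2]) (by linarith [hx.1])
    exact (sub_pos.2 this).ne'
  · intro x _
    positivity

lemma integrableOn_inv_sub_mul_sqrt (a c : ℝ) (hac : a < c) (hc : c < 1) :
    IntegrableOn (fun y => ((y - a) * Real.sqrt (1 - y))⁻¹) (Set.Ioc c 1) :=
  intervalIntegral.integrableOn_deriv_of_nonneg (continuousOn_log_sqrt_sub a c hac hc)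
    (fun y hy => hasDerivAt_log_sqrt_sub a y (hac.trans hy.1) hy.2)
    (fun y hy => inv_nonneg.2
      (mul_nonneg (by linarith [hy.1]) (Real.sqrt_nonneg _)))

lemma integral_inv_sub_mul_sqrt (a c : ℝ) (hac : a < c) (hc : c < 1) :
    ∫ y in Set.Ioo c 1, ((y - a) * Real.sqrt (1 - y))⁻¹ =
      (Real.sqrt (1 - a))⁻¹ *
        (2 * Real.log (Real.sqrt (1 - a) + Real.sqrt (1 - c)) - Real.log (c - a)) := by
  rw [← integral_Ioc_eq_integral_Ioo, ← intervalIntegral.integral_of_le hc.le,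
    intervalIntegral.integral_eq_sub_of_hasDerivAt_of_le hc.le
      (continuousOn_log_sqrt_sub a c hac hc)
      (fun y hy => hasDerivAt_log_sqrt_sub a y (hac.trans hy.1) hy.2)
      ((intervalIntegrable_iff_integrableOn_Ioc_of_le hc.le).2
        (integrableOn_inv_sub_mul_sqrt a c hac hc))]
  have hbu : Real.sqrt (1 - c) < Real.sqrt (1 - a) :=
    Real.sqrt_lt_sqrt (by linarith) (by linarith)
  have hu : 0 ≤ Real.sqrt (1 - c) := Real.sqrt_nonneg _
  have hu2 : Real.sqrt (1 - c) ^ 2 = 1 - c := Real.sq_sqrt (by linarith)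
  have hb2 : Real.sqrt (1 - a) ^ 2 = 1 - a := Real.sq_sqrt (by linarith)
  have hca : c - a = (Real.sqrt (1 - a) - Real.sqrt (1 - c)) *
      (Real.sqrt (1 - a) + Real.sqrt (1 - c)) := by linear_combination hu2 - hb2
  rw [hca, Real.log_mul (by linarith) (by linarith)]
  simp only [sub_self, Real.sqrt_zero, sub_zero, add_zero, mul_zero]
  ring

/-- For all `0 < ε < 1` and `s, t ∈ [0,1)`:
`∫_ε^1 1/(√(y−εs)·√(y−εt)·√(1−y)) dy
  ≤ (log(1/ε) + log(e²/(1−max(s,t))))·(1−max(s,t))^{−1/2} + 1`. -/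
theorem y_integral_upper_bound (ε s t : ℝ) (hε : 0 < ε) (hε1 : ε < 1)
    (hs : s ∈ Set.Ico (0 : ℝ) 1) (ht : t ∈ Set.Ico (0 : ℝ) 1) :
    (∫ y in Set.Ioo ε 1,
        (Real.sqrt (y - ε * s) * Real.sqrt (y - ε * t) * Real.sqrt (1 - y))⁻¹)
      ≤ (Real.log (1 / ε) + Real.log (Real.exp 1 ^ 2 / (1 - max s t))) *
          (Real.sqrt (1 - max s t))⁻¹ + 1 := by
  have hsm : s ≤ max s t := le_max_left s t
  have htm : t ≤ max s t := le_max_right s t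
  have hm1 : max s t < 1 := max_lt hs.2 ht.2
  have hm0 : 0 ≤ max s t := hs.1.trans hsm
  set m := max s t
  have ha : ε * m < ε := by nlinarith
  have hmono : (∫ y in Set.Ioo ε 1,
      (Real.sqrt (y - ε * s) * Real.sqrt (y - ε * t) * Real.sqrt (1 - y))⁻¹) ≤
      ∫ y in Set.Ioo ε 1, ((y - ε * m) * Real.sqrt (1 - y))⁻¹ := by
    refine integral_mono_of_nonneg (Filter.Eventually.of_forall fun y => ?_)
      ((integrableOn_inv_sub_mul_sqrt _ ε ha hε1).mono_set Set.Ioo_subset_Ioc_self) ?_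
    · simp only [Pi.zero_apply]
      positivity
    · filter_upwards [ae_restrict_mem measurableSet_Ioo] with y hy
      have hya : 0 < y - ε * m := by linarith [hy.1]
      have hu : 0 < Real.sqrt (1 - y) := Real.sqrt_pos.2 (by linarith [hy.2])
      have hprod : y - ε * m ≤ Real.sqrt (y - ε * s) * Real.sqrt (y - ε * t) := by
        rw [← Real.mul_self_sqrt hya.le]
        gcongr
      gcongr
  refine hmono.trans ?_
  rw [integral_inv_sub_mul_sqrt _ ε ha hε1]
  have hb1 : Real.sqrt (1 - ε * m) ≤ 1 := Real.sqrt_le_one.2 (by nlinarith)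
  have hu1 : Real.sqrt (1 - ε) ≤ 1 := Real.sqrt_le_one.2 (by linarith)
  have hbpos : 0 < Real.sqrt (1 - ε * m) := Real.sqrt_pos.2 (by linarith)
  have hlog : Real.log (Real.sqrt (1 - ε * m) + Real.sqrt (1 - ε)) ≤ 1 := by
    have hu := Real.sqrt_nonneg (1 - ε)
    have := Real.log_le_sub_one_of_pos (add_pos_of_pos_of_nonneg hbpos hu)
    linarith
  have hsub : Real.log (ε - ε * m) = Real.log ε + Real.log (1 - m) := by
    rw [← Real.log_mul hε.ne' (by linarith)]
    ring_nf
  have hlε : Real.log ε ≤ 0 := Real.log_nonpos hε.le hε1.le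
  have hlm : Real.log (1 - m) ≤ 0 := Real.log_nonpos (by linarith) (by linarith)
  have hinv : (Real.sqrt (1 - ε * m))⁻¹ ≤ (Real.sqrt (1 - m))⁻¹ := by
    have : 0 < Real.sqrt (1 - m) := Real.sqrt_pos.2 (by linarith)
    gcongr
    nlinarith
  have hrhs : Real.log (1 / ε) + Real.log (Real.exp 1 ^ 2 / (1 - m)) =
      2 - Real.log ε - Real.log (1 - m) := by
    rw [one_div, Real.log_inv, Real.log_div (by positivity) (by linarith), Real.log_pow,
      Real.log_exp]
    push_cast
    ring
  rw [hsub, hrhs]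
  calc _ ≤ (Real.sqrt (1 - ε * m))⁻¹ * (2 - Real.log ε - Real.log (1 - m)) :=
        mul_le_mul_of_nonneg_left (by linarith) (inv_nonneg.2 hbpos.le)
    _ ≤ (Real.sqrt (1 - m))⁻¹ * (2 - Real.log ε - Real.log (1 - m)) :=
        mul_le_mul_of_nonneg_right hinv (by linarith)
    _ ≤ _ := by linarith
end

section
/- There exists a universal constant C > 0 such that for all 0 < δ ≤ η ≤ 1 and all x ∈ [−η, −δ], the quantity ζ(x) := ∫_x^∞ v^{−1}·(v−x)^{−1/2}·1_{δ ≤ |v| ≤ η} dv satisfies | ζ(x) | ≤ C·( δ·(−x)^{−3/2} + η^{−1/2} ). -/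
open MeasureTheory

/-- A primitive of `v ↦ (v * √(v + a))⁻¹`. -/
noncomputable def zetaPrimitive (a v : ℝ) : ℝ :=
  (Real.log (√(v + a) - √a) - Real.log (√(v + a) + √a)) / √a

theorem hasDerivAt_zetaPrimitive {a v : ℝ} (ha : 0 < a) (hv : 0 < v + a) (hv0 : v ≠ 0) :
    HasDerivAt (zetaPrimitive a) (v * √(v + a))⁻¹ v := by
  have hr : 0 < √a := Real.sqrt_pos.2 ha
  have hs : 0 < √(v + a) := Real.sqrt_pos.2 hv
  have hr2 : √a ^ 2 = a := Real.sq_sqrt ha.le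
  have hs2 : √(v + a) ^ 2 = v + a := Real.sq_sqrt hv.le
  have hprod : (√(v + a) - √a) * (√(v + a) + √a) = v := by linear_combination hs2 - hr2
  have hne : √(v + a) - √a ≠ 0 := by
    intro h
    rw [h, zero_mul] at hprod
    exact hv0 hprod.symm
  have hne' : √(v + a) + √a ≠ 0 := by positivity
  have hd : HasDerivAt (fun v => √(v + a)) (1 / (2 * √(v + a))) v :=
    ((hasDerivAt_id v).add_const a).sqrt hv.ne'
  have h := (((hd.sub_const √a).log hne).sub ((hd.add_const √a).log hne')).div_const √a
  refine h.congr_deriv ?_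
  generalize √(v + a) = s at *
  rw [← hprod]
  field_simp
  ring

theorem continuousOn_zetaPrimitive {a : ℝ} (ha : 0 < a) :
    ContinuousOn (zetaPrimitive a) (Set.Ici (-a) ∩ {0}ᶜ) := by
  have hr : 0 < √a := Real.sqrt_pos.2 ha
  unfold zetaPrimitive
  refine ContinuousOn.div_const (ContinuousOn.sub ?_ ?_) _
  · refine ContinuousOn.log (by fun_prop) fun v hv h => hv.2 ?_
    have h1 : v + a = a :=
      (Real.sqrt_inj (by linarith [Set.mem_Ici.1 hv.1]) ha.le).1 (sub_eq_zero.1 h)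
    simpa using h1
  · exact ContinuousOn.log (by fun_prop) fun v _ => by positivity

theorem intervalIntegral_of_forall_hasDerivAt_of_nonneg {f f' : ℝ → ℝ} {b c : ℝ} (hbc : b ≤ c)
    (hf : ContinuousOn f (Set.Icc b c)) (hd : ∀ v ∈ Set.Ioo b c, HasDerivAt f (f' v) v)
    (h0 : ∀ v ∈ Set.Ioo b c, 0 ≤ f' v) :
    IntegrableOn f' (Set.Ioc b c) ∧ ∫ v in Set.Ioc b c, f' v = f c - f b := by
  have hi := intervalIntegral.integrableOn_deriv_of_nonneg hf hd h0
  refine ⟨hi, ?_⟩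
  rw [← intervalIntegral.integral_of_le hbc]
  exact intervalIntegral.integral_eq_sub_of_hasDerivAt_of_le hbc hf hd
    ((intervalIntegrable_iff_integrableOn_Ioc_of_le hbc).2 hi)

/-- The truncated integral in closed form. -/
theorem integral_truncated_eq_zetaPrimitive {δ η a : ℝ} (hδ : 0 < δ) (hδη : δ ≤ η) (haη : a ≤ η)
    (hδa : δ ≤ a) :
    (∫ v in Set.Ioi (-a), if δ ≤ |v| ∧ |v| ≤ η then (v * √(v + a))⁻¹ else 0)
      = zetaPrimitive a (-δ) - zetaPrimitive a (-a)
        + (zetaPrimitive a η - zetaPrimitive a δ) := by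
  have ha : 0 < a := hδ.trans_le hδa
  have hneg := intervalIntegral_of_forall_hasDerivAt_of_nonneg
    (f := fun v => -zetaPrimitive a v) (f' := fun v => -(v * √(v + a))⁻¹)
    (b := -a) (c := -δ) (by linarith)
    ((continuousOn_zetaPrimitive ha).neg.mono fun v hv =>
      ⟨hv.1, by have := hv.2; simp only [Set.mem_compl_iff, Set.mem_singleton_iff]; linarith⟩)
    (fun v hv => (hasDerivAt_zetaPrimitive ha (by linarith [hv.1])
      (by have := hv.2; linarith)).neg)
    (fun v hv => neg_nonneg.2 <| inv_nonpos.2 <|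
      mul_nonpos_of_nonpos_of_nonneg (by linarith [hv.2]) (Real.sqrt_nonneg _))
  have hpos := intervalIntegral_of_forall_hasDerivAt_of_nonneg
    (f := zetaPrimitive a) (f' := fun v => (v * √(v + a))⁻¹) hδη
    ((continuousOn_zetaPrimitive ha).mono fun v hv =>
      ⟨by have := hv.1; simp only [Set.mem_Ici]; linarith,
        by have := hv.1; simp only [Set.mem_compl_iff, Set.mem_singleton_iff]; linarith⟩)
    (fun v hv => hasDerivAt_zetaPrimitive ha (by linarith [hv.1]) (by linarith [hv.1]))
    (fun v hv => by have : 0 < v := hδ.trans hv.1; positivity)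
  have hdisj : Disjoint (Set.Ioc (-a) (-δ)) (Set.Icc δ η) :=
    Set.disjoint_left.2 fun v hv hv' => by linarith [hv.2, hv'.1]
  have hset : ∀ v ∈ Set.Ioi (-a), (if δ ≤ |v| ∧ |v| ≤ η then (v * √(v + a))⁻¹ else 0)
      = (Set.Ioc (-a) (-δ) ∪ Set.Icc δ η).indicator (fun v => (v * √(v + a))⁻¹) v := by
    intro v hv
    have hv : -a < v := hv
    rw [Set.indicator_apply]
    refine if_congr ?_ rfl rfl
    simp only [Set.mem_union, Set.mem_Ioc, Set.mem_Icc, le_abs, abs_le]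
    constructor
    · rintro ⟨h | h, -, h'⟩
      · exact Or.inr ⟨h, h'⟩
      · exact Or.inl ⟨hv, by linarith⟩
    · rintro (⟨h, h'⟩ | ⟨h, h'⟩)
      · exact ⟨Or.inr (by linarith), by linarith, by linarith⟩
      · exact ⟨Or.inl h, by linarith, h'⟩
  have hsub : Set.Ioc (-a) (-δ) ∪ Set.Icc δ η ⊆ Set.Ioi (-a) := by
    rintro v (hv | hv)
    · exact hv.1
    · have := hv.1
      simp only [Set.mem_Ioi]
      linarith
  have hint : IntegrableOn (fun v => (v * √(v + a))⁻¹) (Set.Ioc (-a) (-δ)) := by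
    simpa using hneg.1.neg
  rw [setIntegral_congr_fun measurableSet_Ioi hset,
    setIntegral_indicator (measurableSet_Ioc.union measurableSet_Icc),
    Set.inter_eq_self_of_subset_right hsub,
    setIntegral_union hdisj measurableSet_Icc hint
      ((integrableOn_Icc_iff_integrableOn_Ioc).2 hpos.1),
    integral_Icc_eq_integral_Ioc, hpos.2]
  have h := hneg.2
  rw [integral_neg] at h
  linarith

theorem Real.log_sub_log_le_sub_div {u w : ℝ} (hu : 0 < u) (hw : 0 < w) :
    Real.log w - Real.log u ≤ (w - u) / u := by
  rw [← Real.log_div hw.ne' hu.ne', sub_div, div_self hu.ne']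
  exact Real.log_le_sub_one_of_pos (div_pos hw hu)

theorem abs_zetaPrimitive_le {η a : ℝ} (ha : 0 < a) (haη : a ≤ η) :
    |zetaPrimitive a η| ≤ 5 / √η := by
  have hη : 0 < η := ha.trans_le haη
  have hr : 0 < √a := Real.sqrt_pos.2 ha
  have hw : 0 < √η := Real.sqrt_pos.2 hη
  have hrw : √a ≤ √η := Real.sqrt_le_sqrt haη
  have hr2 : √a ^ 2 = a := Real.sq_sqrt ha.le
  have hw2 : √η ^ 2 = η := Real.sq_sqrt hη.le
  have ht2 : √(η + a) ^ 2 = η + a := Real.sq_sqrt (by linarith)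
  have hrt : √a < √(η + a) := Real.sqrt_lt_sqrt ha.le (by linarith)
  have htw : √(η + a) ≤ 3 / 2 * √η := Real.sqrt_le_iff.2 ⟨by positivity, by nlinarith⟩
  have hsub : 0 < √(η + a) - √a := sub_pos.2 hrt
  have hmono := Real.log_le_log hsub (by linarith : √(η + a) - √a ≤ √(η + a) + √a)
  have hlog := Real.log_sub_log_le_sub_div hsub (by linarith : 0 < √(η + a) + √a)
  have hbound : (√(η + a) + √a - (√(η + a) - √a)) / (√(η + a) - √a) ≤ 5 / √η * √a := by
    rw [div_mul_eq_mul_div, div_le_div_iff₀ hsub hw]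
    have hprod : (√(η + a) - √a) * (√(η + a) + √a) = √η * √η := by
      linear_combination ht2 - hr2 - hw2
    have hkey : 2 * √η ≤ 5 * (√(η + a) - √a) := by
      have : √η * √η ≤ (√(η + a) - √a) * (5 / 2 * √η) := by
        rw [← hprod]
        exact mul_le_mul_of_nonneg_left (by linarith) hsub.le
      nlinarith
    nlinarith
  rw [zetaPrimitive, abs_div, abs_of_pos hr, div_le_iff₀ hr, abs_le]
  constructor
  · linarith
  · have : 0 ≤ 5 / √η * √a := by positivity
    linarith

theorem abs_zetaPrimitive_neg_sub_le {δ a : ℝ} (hδ : 0 < δ) (hδa : δ ≤ a) :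
    |zetaPrimitive a (-δ) - zetaPrimitive a δ| ≤ 4 * (δ / √a ^ 3) := by
  have ha : 0 < a := hδ.trans_le hδa
  have hr : 0 < √a := Real.sqrt_pos.2 ha
  have hp : 0 ≤ √(-δ + a) := Real.sqrt_nonneg _
  have hr2 : √a ^ 2 = a := Real.sq_sqrt ha.le
  have hp2 : √(-δ + a) ^ 2 = -δ + a := Real.sq_sqrt (by linarith)
  have hq2 : √(δ + a) ^ 2 = δ + a := Real.sq_sqrt (by linarith)
  have hpr : √(-δ + a) < √a := Real.sqrt_lt_sqrt (by linarith) (by linarith)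
  have hrq : √a < √(δ + a) := Real.sqrt_lt_sqrt ha.le (by linarith)
  rw [zetaPrimitive, zetaPrimitive]
  generalize √(-δ + a) = p at *
  generalize √(δ + a) = q at *
  generalize √a = r at *
  have h1 : Real.log (p - r) = Real.log δ - Real.log (p + r) := by
    rw [← Real.log_neg_eq_log, ← Real.log_div hδ.ne' (by positivity)]
    congr 1
    rw [eq_div_iff (by positivity)]
    linear_combination hr2 - hp2
  have h2 : Real.log (q - r) = Real.log δ - Real.log (q + r) := by
    rw [← Real.log_div hδ.ne' (by linarith)]
    congr 1
    rw [eq_div_iff (by linarith)]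
    linear_combination hq2 - hr2
  have hmono := Real.log_le_log (by linarith : 0 < p + r) (by linarith : p + r ≤ q + r)
  have hlog := Real.log_sub_log_le_sub_div (by linarith : 0 < p + r) (by linarith : 0 < q + r)
  have hbound : (q + r - (p + r)) / (p + r) ≤ 2 * (δ / r ^ 2) := by
    have hqp : (q - p) * r ≤ 2 * δ := by nlinarith
    calc (q + r - (p + r)) / (p + r) ≤ (q - p) / r := by
          rw [add_sub_add_right_eq_sub]
          exact div_le_div_of_nonneg_left (by linarith) hr (by linarith)
      _ = (q - p) * r / r ^ 2 := by field_simp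
      _ ≤ 2 * δ / r ^ 2 := by gcongr
      _ = 2 * (δ / r ^ 2) := by ring
  rw [h1, h2, ← sub_div, abs_div, abs_of_pos hr, div_le_iff₀ hr, abs_of_nonneg (by linarith)]
  have : 4 * (δ / r ^ 3) * r = 4 * (δ / r ^ 2) := by field_simp
  linarith

theorem zetaPrimitive_neg_self (a : ℝ) : zetaPrimitive a (-a) = 0 := by
  simp [zetaPrimitive]

/-- There is a universal constant `C > 0` such that for all `0 < δ ≤ η ≤ 1` and
`x ∈ [−η, −δ]`, `|ζ(x)| ≤ C·(δ·(−x)^{−3/2} + η^{−1/2})`, where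
`ζ(x) = ∫_x^∞ v^{−1}·(v−x)^{−1/2}·1_{δ ≤ |v| ≤ η} dv`. -/
theorem zeta_middle_bound :
    ∃ C > (0 : ℝ), ∀ δ η x : ℝ, 0 < δ → δ ≤ η → η ≤ 1 → -η ≤ x → x ≤ -δ →
      |∫ v in Set.Ioi x, if δ ≤ |v| ∧ |v| ≤ η then (v * Real.sqrt (v - x))⁻¹ else 0|
        ≤ C * (δ * (-x) ^ (-(3 / 2) : ℝ) + η ^ (-(1 / 2) : ℝ)) := by
  refine ⟨5, by norm_num, fun δ η x hδ hδη _ hηx hxδ => ?_⟩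
  obtain ⟨a, rfl⟩ : ∃ a, x = -a := ⟨-x, (neg_neg x).symm⟩
  have hδa : δ ≤ a := by linarith
  have haη : a ≤ η := by linarith
  have ha : 0 < a := hδ.trans_le hδa
  have hη : 0 < η := hδ.trans_le hδη
  have hr : 0 < √a := Real.sqrt_pos.2 ha
  have hpow_a : a ^ (-(3 / 2) : ℝ) = (√a ^ 3)⁻¹ := by
    rw [Real.rpow_neg ha.le, Real.sqrt_eq_rpow, ← Real.rpow_mul_natCast ha.le]
    norm_num
  have hpow_η : η ^ (-(1 / 2) : ℝ) = (√η)⁻¹ := by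
    rw [Real.rpow_neg hη.le, Real.sqrt_eq_rpow]
  simp only [sub_neg_eq_add, neg_neg]
  rw [integral_truncated_eq_zetaPrimitive hδ hδη haη hδa, zetaPrimitive_neg_self, hpow_a, hpow_η,
    ← div_eq_mul_inv]
  have h1 := abs_zetaPrimitive_neg_sub_le hδ hδa
  have h2 := abs_zetaPrimitive_le ha haη
  have h3 : 0 ≤ δ / √a ^ 3 := by positivity
  rw [div_eq_mul_inv] at h2
  calc |zetaPrimitive a (-δ) - 0 + (zetaPrimitive a η - zetaPrimitive a δ)|
      = |(zetaPrimitive a (-δ) - zetaPrimitive a δ) + zetaPrimitive a η| := by congr 1; ring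
    _ ≤ |zetaPrimitive a (-δ) - zetaPrimitive a δ| + |zetaPrimitive a η| := abs_add_le _ _
    _ ≤ 5 * (δ / √a ^ 3 + (√η)⁻¹) := by linarith
end

section
/- Let x ≥ 0, γ > 1/2, and let g be a measurable function on a neighborhood of x that is continuous at x with g(x) > 0. Let (η_n) satisfy η_n ∈ (0,1], η_n → 0, and η_n ≥ c·(log n)^{−α} for some c > 0 and α ∈ (0,1). Then lim_{n→∞} (1/log n) · ∫_{x + n^{−1/(2γ)}}^{x + η_n} 1/( (z−x)·g(z) ) dz = 1/( 2γ·g(x) ). -/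
open MeasureTheory

theorem integrableOn_Ioo_inv_sub {x a b : ℝ} (ha : 0 < a) :
    IntegrableOn (fun z : ℝ => (z - x)⁻¹) (Set.Ioo (x + a) (x + b)) := by
  refine IntegrableOn.mono_set (ContinuousOn.integrableOn_Icc ?_) Set.Ioo_subset_Icc_self
  refine ContinuousOn.inv₀ (by fun_prop) fun z hz => ?_
  have := hz.1
  linarith

theorem setIntegral_Ioo_inv_sub {x a b : ℝ} (ha : 0 < a) (hab : a ≤ b) :
    ∫ z in Set.Ioo (x + a) (x + b), (z - x)⁻¹ = Real.log (b / a) := by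
  rw [← integral_Ioc_eq_integral_Ioo, ← intervalIntegral.integral_of_le (by linarith),
    intervalIntegral.integral_comp_sub_right (fun z => z⁻¹) x, add_sub_cancel_left,
    add_sub_cancel_left, integral_inv_of_pos ha (ha.trans_le hab)]

theorem abs_setIntegral_inv_sub_mul_sub_le {x a b L ε : ℝ} (ha : 0 < a) (hab : a ≤ b)
    {h : ℝ → ℝ} (hm : AEStronglyMeasurable h (volume.restrict (Set.Ioo (x + a) (x + b))))
    (hb : ∀ z ∈ Set.Ioo (x + a) (x + b), |h z - L| ≤ ε) :
    |(∫ z in Set.Ioo (x + a) (x + b), (z - x)⁻¹ * h z) - L * Real.log (b / a)|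
      ≤ ε * Real.log (b / a) := by
  have hi : Integrable (fun z : ℝ => (z - x)⁻¹) (volume.restrict (Set.Ioo (x + a) (x + b))) :=
    integrableOn_Ioo_inv_sub ha
  have hle : ∀ᵐ z ∂volume.restrict (Set.Ioo (x + a) (x + b)),
      ‖(z - x)⁻¹ * (h z - L)‖ ≤ ε * (z - x)⁻¹ := by
    filter_upwards [ae_restrict_mem measurableSet_Ioo] with z hz
    have hz0 : 0 < (z - x)⁻¹ := inv_pos.2 (by linarith [hz.1])
    rw [norm_mul, Real.norm_eq_abs, Real.norm_eq_abs, abs_of_pos hz0, mul_comm]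
    exact mul_le_mul_of_nonneg_right (hb z hz) hz0.le
  have hd : Integrable (fun z : ℝ => (z - x)⁻¹ * (h z - L))
      (volume.restrict (Set.Ioo (x + a) (x + b))) :=
    (hi.const_mul ε).mono' (hi.aestronglyMeasurable.mul (hm.sub aestronglyMeasurable_const)) hle
  have hsplit : (fun z : ℝ => (z - x)⁻¹ * h z) =
      fun z => (z - x)⁻¹ * (h z - L) + L * (z - x)⁻¹ := by
    ext z
    ring
  rw [hsplit, integral_add hd (hi.const_mul L), integral_const_mul,
    setIntegral_Ioo_inv_sub ha hab, add_sub_cancel_right, ← Real.norm_eq_abs,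
    ← setIntegral_Ioo_inv_sub (x := x) ha hab, ← integral_const_mul]
  exact norm_integral_le_of_norm_le (hi.const_mul ε) hle

theorem tendsto_log_natCast_atTop :
    Filter.Tendsto (fun n : ℕ => Real.log n) Filter.atTop Filter.atTop :=
  Real.tendsto_log_atTop.comp tendsto_natCast_atTop_atTop

theorem tendsto_log_div_log_of_rpow_le {c α : ℝ} (hc : 0 < c) {η : ℕ → ℝ}
    (hη1 : ∀ n, η n ∈ Set.Ioc (0 : ℝ) 1)
    (hη : ∀ n : ℕ, 2 ≤ n → c * (Real.log n) ^ (-α) ≤ η n) :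
    Filter.Tendsto (fun n : ℕ => Real.log (η n) / Real.log n) Filter.atTop (nhds 0) := by
  have hlog := tendsto_log_natCast_atTop
  have hll : Filter.Tendsto (fun n : ℕ => Real.log (Real.log n) / Real.log n)
      Filter.atTop (nhds 0) :=
    Real.isLittleO_log_id_atTop.tendsto_div_nhds_zero.comp hlog
  have hlow : Filter.Tendsto
      (fun n : ℕ => Real.log c / Real.log n - α * (Real.log (Real.log n) / Real.log n))
      Filter.atTop (nhds 0) := by
    simpa using (hlog.const_div_atTop (Real.log c)).sub (hll.const_mul α)
  refine tendsto_of_tendsto_of_tendsto_of_le_of_le' hlow tendsto_const_nhds ?_ ?_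
  · filter_upwards [Filter.eventually_ge_atTop 2, hlog.eventually_gt_atTop 0] with n hn hpos
    have hmono := Real.log_le_log (by positivity) (hη n hn)
    rw [Real.log_mul hc.ne' (Real.rpow_pos_of_pos hpos _).ne', Real.log_rpow hpos] at hmono
    rw [← mul_div_assoc, ← sub_div]
    exact div_le_div_of_nonneg_right (by linarith) hpos.le
  · filter_upwards [hlog.eventually_gt_atTop 0] with n hpos
    exact div_nonpos_of_nonpos_of_nonneg (Real.log_nonpos (hη1 n).1.le (hη1 n).2) hpos.le

theorem aestronglyMeasurable_inv_restrict_of_subset {g : ℝ → ℝ} {U S : Set ℝ}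
    (hg : Measurable (U.domRestrict g)) (hS : MeasurableSet S) (hSU : S ⊆ U) :
    AEStronglyMeasurable (fun z => (g z)⁻¹) (volume.restrict S) :=
  (aemeasurable_restrict_of_measurable_subtype hS
    (hg.comp (measurable_inclusion hSU))).inv.aestronglyMeasurable

/-- If `g` is measurable on a neighborhood of `x`, continuous at `x` with `g(x) > 0`,
then `(1/log n)·∫_{x+n^{−1/(2γ)}}^{x+η_n} 1/((z−x)·g(z)) dz → 1/(2γ·g(x))`. -/
theorem log_integral_limit (x γ c α : ℝ) (hx : 0 ≤ x) (hγ : 1 / 2 < γ)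
    (g : ℝ → ℝ) (U : Set ℝ) (hU : U ∈ nhds x)
    (hmeas : Measurable (U.restrict g))
    (hcont : ContinuousAt g x) (hgx : 0 < g x)
    (η : ℕ → ℝ) (hη1 : ∀ n, η n ∈ Set.Ioc (0 : ℝ) 1)
    (hη2 : Filter.Tendsto η Filter.atTop (nhds 0))
    (hc : 0 < c) (hα : α ∈ Set.Ioo (0 : ℝ) 1)
    (hη3 : ∀ n : ℕ, 2 ≤ n → c * (Real.log n) ^ (-α) ≤ η n) :
    Filter.Tendsto
      (fun n : ℕ => (1 / Real.log n) *
        ∫ z in Set.Ioo (x + (n : ℝ) ^ (-(1 / (2 * γ)))) (x + η n), ((z - x) * g z)⁻¹)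
      Filter.atTop (nhds (1 / (2 * γ * g x))) := by
  have hlog := tendsto_log_natCast_atTop
  set a : ℕ → ℝ := fun n => (n : ℝ) ^ (-(1 / (2 * γ))) with ha_def
  have hJ : Filter.Tendsto (fun n : ℕ => Real.log (η n / a n) / Real.log n)
      Filter.atTop (nhds (1 / (2 * γ))) := by
    have h := (tendsto_log_div_log_of_rpow_le hc hη1 hη3).add_const (1 / (2 * γ))
    rw [zero_add] at h
    refine h.congr' ?_
    filter_upwards [Filter.eventually_gt_atTop 0, hlog.eventually_gt_atTop 0] with n hn hpos
    have hn' : (0 : ℝ) < n := Nat.cast_pos.2 hn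
    rw [Real.log_div (hη1 n).1.ne' (Real.rpow_pos_of_pos hn' _).ne', Real.log_rpow hn', sub_div,
      mul_div_cancel_right₀ _ hpos.ne', sub_neg_eq_add]
  have hγ0 : 0 < 1 / (2 * γ) := by positivity
  have hmain : Filter.Tendsto
      (fun n : ℕ => (1 / Real.log n) *
        (∫ z in Set.Ioo (x + a n) (x + η n), ((z - x) * g z)⁻¹) -
          (g x)⁻¹ * (Real.log (η n / a n) / Real.log n))
      Filter.atTop (nhds 0) := by
    rw [Metric.tendsto_nhds]
    intro ε hε
    have hε' : 0 < ε * γ := by positivity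
    obtain ⟨δ, hδ, hball⟩ := Metric.eventually_nhds_iff.1
      (Filter.Eventually.and (Metric.tendsto_nhds.1 (hcont.inv₀ hgx.ne') (ε * γ) hε') hU)
    filter_upwards [Filter.eventually_gt_atTop 0, hlog.eventually_gt_atTop 0,
      hη2.eventually_lt_const hδ, hJ.eventually_const_lt hγ0,
      hJ.eventually_lt_const (show 1 / (2 * γ) < 1 / γ by gcongr; linarith)]
      with n hn hpos hηδ hJ0 hJ1
    have han : 0 < a n := Real.rpow_pos_of_pos (Nat.cast_pos.2 hn) _
    have hab : a n ≤ η n := by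
      have h1 : 0 < Real.log (η n / a n) := by
        simpa [div_mul_cancel₀ _ hpos.ne'] using mul_pos hJ0 hpos
      have h2 := (Real.log_pos_iff (div_pos (hη1 n).1 han).le).1 h1
      exact ((one_lt_div han).1 h2).le
    have hnear : ∀ z ∈ Set.Ioo (x + a n) (x + η n), dist z x < δ := fun z hz => by
      rw [Real.dist_eq, abs_lt]
      constructor <;> linarith [hz.1, hz.2]
    have hbound := abs_setIntegral_inv_sub_mul_sub_le (L := (g x)⁻¹) (ε := ε * γ) han hab
      (aestronglyMeasurable_inv_restrict_of_subset hmeas measurableSet_Ioo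
        fun z hz => (hball (hnear z hz)).2)
      fun z hz => (hball (hnear z hz)).1.le
    simp only [mul_inv]
    rw [Real.dist_eq, sub_zero, one_div_mul_eq_div, ← mul_div_assoc, ← sub_div, abs_div,
      abs_of_pos hpos]
    calc _ ≤ ε * γ * Real.log (η n / a n) / Real.log n :=
          div_le_div_of_nonneg_right hbound hpos.le
      _ = ε * γ * (Real.log (η n / a n) / Real.log n) := mul_div_assoc _ _ _
      _ < ε * γ * (1 / γ) := mul_lt_mul_of_pos_left hJ1 hε'
      _ = ε := by field_simp
  have h := hmain.add (hJ.const_mul (g x)⁻¹)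
  simp only [sub_add_cancel, zero_add] at h
  convert h using 2
  field_simp
end
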